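/- Proposition 14.7 (pointwise form): Let V be a finite-dimensional real vector space, and let ρ, κ, ζ be complex-valued 1-forms on V such that ρ̄ = ρ and ρ, κ, ζ, κ̄, ζ̄ are linearly independent over ℂ. Let R ∈ ℝ and W ∈ ℂ be scalars, and let Ω₁, Ω₂ be complex-valued 2-forms on V satisfying (Ω₁ + Ω̄₁) ∧ ρ = 0 and Ω₂ ∧ ρ + Ω₁ ∧ κ = −R·ρ ∧ ζ ∧ κ̄ − W·κ ∧ ζ ∧ κ̄. Then there exist a real scalar p ∈ ℝ and complex-valued 1-forms Π and Ψ on V such that Ω₁ = Π ∧ ρ + p·κ ∧ κ̄ − W̄·κ ∧ ζ̄ − W·ζ ∧ κ̄ and Ω₂ = Ψ ∧ ρ + Π ∧ κ − R·ζ ∧ κ̄. -/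

import Mathlib

open Complex

/-- Complex-valued `p`-forms on a real vector space `V`: alternating
`ℝ`-multilinear maps `V^p → ℂ`. -/
abbrev CForm (V : Type*) [AddCommGroup V] [Module ℝ V] (p : ℕ) :=
  V [⋀^Fin p]→ₗ[ℝ] ℂ

/-- Wedge product of complex-valued alternating forms. -/
noncomputable def cwedge {V : Type*} [AddCommGroup V] [Module ℝ V] {p q : ℕ}
    (ω : CForm V p) (η : CForm V q) : CForm V (p + q) :=
  ((LinearMap.mul' ℝ ℂ).compAlternatingMap (ω.domCoprod η)).domDomCongr finSumFinEquiv

/-- Conjugate of a complex-valued form, obtained by postcomposing with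
complex conjugation. -/
def cconj {V : Type*} [AddCommGroup V] [Module ℝ V] {p : ℕ}
    (ω : CForm V p) : CForm V p :=
  Complex.conjAe.toLinearMap.compAlternatingMap ω

open scoped Nat in
theorem factorial_smul_cwedge_apply {V : Type*} [AddCommGroup V] [Module ℝ V] {p q : ℕ}
    (ω : CForm V p) (η : CForm V q) (v : Fin (p + q) → V) :
    ((p ! * q !) • cwedge ω η v : ℂ) = ∑ σ : Equiv.Perm (Fin (p + q)),
      Equiv.Perm.sign σ • (ω (fun i => v (σ (Fin.castAdd q i))) *
        η (fun i => v (σ (Fin.natAdd p i)))) := by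
  have h := congrArg (fun f => LinearMap.mul' ℝ ℂ (f (v ∘ finSumFinEquiv)))
    (MultilinearMap.domCoprod_alternization_eq ω η)
  simp only [Fintype.card_fin] at h
  trans LinearMap.mul' ℝ ℂ (((p ! * q !) • ω.domCoprod η) (v ∘ finSumFinEquiv))
  · rw [AlternatingMap.smul_apply, map_nsmul]
    rfl
  · rw [← h, MultilinearMap.alternatization_apply, map_sum]
    refine Fintype.sum_equiv finSumFinEquiv.permCongr _ _ fun σ => ?_
    rw [map_zsmul_unit, Equiv.Perm.sign_permCongr]
    simp [MultilinearMap.domDomCongr_apply]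

theorem AlternatingMap.fin_one_apply_eq {V : Type*} [AddCommGroup V] [Module ℝ V]
    (ω : CForm V 1) (v : Fin 1 → V) : ω v = ω ![v 0] :=
  congrArg ω (List.ofFn_inj.mp rfl)

theorem AlternatingMap.fin_two_apply_eq {V : Type*} [AddCommGroup V] [Module ℝ V]
    (ω : CForm V 2) (v : Fin 2 → V) : ω v = ω ![v 0, v 1] :=
  congrArg ω (List.ofFn_inj.mp rfl)

theorem AlternatingMap.fin_two_swap {V : Type*} [AddCommGroup V] [Module ℝ V]
    (ω : CForm V 2) (x y : V) : ω ![y, x] = -ω ![x, y] := by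
  have h := ω.map_swap ![x, y] (i := 0) (j := 1) (by decide)
  rw [fin_two_apply_eq] at h
  simpa using h

theorem cwedge_apply_one_one {V : Type*} [AddCommGroup V] [Module ℝ V]
    (ω η : CForm V 1) (x y : V) :
    cwedge ω η ![x, y] = ω ![x] * η ![y] - ω ![y] * η ![x] := by
  have h := factorial_smul_cwedge_apply ω η ![x, y]
  have hu : (Finset.univ : Finset (Equiv.Perm (Fin (1 + 1)))) = {1, Equiv.swap 0 1} := by decide
  rw [hu, Finset.sum_pair (by decide)] at h
  obtain ⟨f, hf⟩ : ∃ f : V → ℂ, ∀ v, ω v = f (v 0) := ⟨fun a => ω ![a], ω.fin_one_apply_eq⟩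
  obtain ⟨g, hg⟩ : ∃ g : V → ℂ, ∀ v, η v = g (v 0) := ⟨fun a => η ![a], η.fin_one_apply_eq⟩
  simp only [hf, hg] at h ⊢
  change 1 • cwedge ω η ![x, y] = (1 : ℤˣ) • (f x * g y) + (-1 : ℤˣ) • (f y * g x) at h
  rw [one_smul, one_smul, Units.neg_smul, one_smul] at h
  exact h.trans (sub_eq_add_neg _ _).symm

theorem cwedge_apply_two_one {V : Type*} [AddCommGroup V] [Module ℝ V]
    (ω : CForm V 2) (η : CForm V 1) (x y z : V) :
    cwedge ω η ![x, y, z] =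
      ω ![x, y] * η ![z] - ω ![x, z] * η ![y] + ω ![y, z] * η ![x] := by
  have h := factorial_smul_cwedge_apply ω η ![x, y, z]
  have hu : (Finset.univ : Finset (Equiv.Perm (Fin (2 + 1)))) =
    {1, Equiv.swap 0 1, Equiv.swap 0 2, Equiv.swap 1 2, Equiv.swap 0 1 * Equiv.swap 1 2,
      Equiv.swap 1 2 * Equiv.swap 0 1} := by decide
  rw [hu, Finset.sum_insert (by decide), Finset.sum_insert (by decide),
    Finset.sum_insert (by decide), Finset.sum_insert (by decide), Finset.sum_pair (by decide)] at h
  obtain ⟨f, hf⟩ : ∃ f : V → V → ℂ, ∀ v, ω v = f (v 0) (v 1) :=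
    ⟨fun a b => ω ![a, b], ω.fin_two_apply_eq⟩
  obtain ⟨g, hg⟩ : ∃ g : V → ℂ, ∀ v, η v = g (v 0) := ⟨fun a => η ![a], η.fin_one_apply_eq⟩
  have hs (a b : V) : f b a = -f a b := by simpa [hf] using ω.fin_two_swap a b
  simp only [hf, hg] at h ⊢
  change 2 • cwedge ω η ![x, y, z] = (1 : ℤˣ) • (f x y * g z) + ((-1 : ℤˣ) • (f y x * g z)
    + ((-1 : ℤˣ) • (f z y * g x) + ((-1 : ℤˣ) • (f x z * g y)
    + ((1 : ℤˣ) • (f y z * g x) + (1 : ℤˣ) • (f z x * g y))))) at h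
  simp only [one_smul, Units.neg_smul, nsmul_eq_mul, Nat.cast_ofNat] at h
  rw [hs x y, hs y z, hs x z] at h
  change cwedge ω η ![x, y, z] = f x y * g z - f x z * g y + f y z * g x
  linear_combination h / 2

theorem exists_dual_vectors {V : Type*} [AddCommGroup V] [Module ℝ V]
    (ρ κ : CForm V 1) (hρ : cconj ρ = ρ) (hindep : LinearIndependent ℂ ![ρ, κ, cconj κ])
    (r : ℝ) (c : ℂ) : ∃ v : V, ρ ![v] = r ∧ κ ![v] = c := by
  let ev (ω : CForm V 1) : V →ₗ[ℝ] ℂ :=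
    { toFun := fun v => ω ![v]
      map_add' := fun x y => by simpa using ω.map_vecCons_add ![] x y
      map_smul' := fun a x => by simpa using ω.map_vecCons_smul ![] a x }
  have hre (v : V) : ((ρ ![v]).re : ℂ) = ρ ![v] :=
    Complex.conj_eq_iff_re.mp (DFunLike.congr_fun hρ ![v])
  let L : V →ₗ[ℝ] ℝ × ℂ := (Complex.reLm ∘ₗ ev ρ).prod (ev κ)
  suffices h : LinearMap.range L = ⊤ by
    obtain ⟨v, hv⟩ := LinearMap.range_eq_top.mp h (r, c)
    have hv1 : (ρ ![v]).re = r := congrArg Prod.fst hv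
    exact ⟨v, by rw [← hre, hv1], congrArg Prod.snd hv⟩
  by_contra h
  obtain ⟨f, hf0, hf⟩ := Submodule.exists_le_ker_of_lt_top _ (lt_top_iff_ne_top.mpr h)
  have hfe (s : ℝ) (z : ℂ) :
      f (s, z) = s * f (1, 0) + z.re * f (0, 1) + z.im * f (0, Complex.I) := by
    have : (s, z) = s • ((1, 0) : ℝ × ℂ) + z.re • ((0, 1) : ℝ × ℂ)
        + z.im • ((0, Complex.I) : ℝ × ℂ) := by
      ext <;> simp
    rw [this]; simp only [map_add, map_smul, smul_eq_mul]
  have key := Fintype.linearIndependent_iff.mp hindep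
    ![2 * (f (1, 0) : ℂ), f (0, 1) - Complex.I * f (0, Complex.I),
      f (0, 1) + Complex.I * f (0, Complex.I)] (by
    ext v
    obtain ⟨x, rfl⟩ : ∃ x, v = ![x] := ⟨v 0, by ext i; fin_cases i; rfl⟩
    have hx : f ((ρ ![x]).re, κ ![x]) = 0 := hf ⟨x, rfl⟩
    rw [hfe] at hx
    have hc : cconj κ ![x] = starRingEnd ℂ (κ ![x]) := rfl
    simp only [Fin.sum_univ_three, AlternatingMap.add_apply, AlternatingMap.smul_apply,
      AlternatingMap.zero_apply, Matrix.cons_val, smul_eq_mul, hc]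
    rw [← hre x]
    apply Complex.ext <;> simp <;> linarith)
  have k0 := key 0
  have k1 := key 1
  have h10 : f (1, 0) = 0 := by simpa using k0
  have h01 : f (0, 1) = 0 := by simpa using congrArg Complex.re k1
  have h0I : f (0, Complex.I) = 0 := by simpa using congrArg Complex.im k1
  exact hf0 (LinearMap.ext fun ⟨s, z⟩ => by rw [hfe]; simp [h10, h01, h0I])

/-- Proposition 14.7 (pointwise form): any solution (Ω₁, Ω₂) of equations
(14.2), (14.3) can be written Ω₁ = Π ∧ ρ + p κ ∧ κ̄ - W̄ κ ∧ ζ̄ - W ζ ∧ κ̄ and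
Ω₂ = Ψ ∧ ρ + Π ∧ κ - R ζ ∧ κ̄, with p a real scalar and Π, Ψ 1-forms. -/
theorem stmt_8 {V : Type*} [AddCommGroup V] [Module ℝ V] [FiniteDimensional ℝ V]
    (ρ κ ζ : CForm V 1) (hρ : cconj ρ = ρ)
    (hindep : LinearIndependent ℂ ![ρ, κ, ζ, cconj κ, cconj ζ])
    (R : ℝ) (W : ℂ) (Ω₁ Ω₂ : CForm V 2)
    (h1 : cwedge (Ω₁ + cconj Ω₁) ρ = 0)
    (h2 : cwedge Ω₂ ρ + cwedge Ω₁ κ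
        = -((R : ℂ) • cwedge (cwedge ρ ζ) (cconj κ))
          - W • cwedge (cwedge κ ζ) (cconj κ)) :
    ∃ (p : ℝ) (Pi Psi : CForm V 1),
      Ω₁ = cwedge Pi ρ + (p : ℂ) • cwedge κ (cconj κ)
            - (starRingEnd ℂ W) • cwedge κ (cconj ζ) - W • cwedge ζ (cconj κ) ∧
      Ω₂ = cwedge Psi ρ + cwedge Pi κ - (R : ℂ) • cwedge ζ (cconj κ) := by
  have hind3 : LinearIndependent ℂ ![ρ, κ, cconj κ] := by
    have := hindep.comp ![0, 1, 3] (by decide)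
    convert this using 1
    ext i; fin_cases i <;> rfl
  have hr (x : V) : starRingEnd ℂ (ρ ![x]) = ρ ![x] := DFunLike.congr_fun hρ ![x]
  have hc1 (ω : CForm V 1) (x : V) : cconj ω ![x] = starRingEnd ℂ (ω ![x]) := rfl
  have hc2 (ω : CForm V 2) (x y : V) : cconj ω ![x, y] = starRingEnd ℂ (ω ![x, y]) := rfl
  obtain ⟨e₀, hρ₀, hκ₀⟩ := exists_dual_vectors ρ κ hρ hind3 1 0
  obtain ⟨e₁, hρ₁, hκ₁⟩ := exists_dual_vectors ρ κ hρ hind3 0 1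
  obtain ⟨e₂, hρ₂, hκ₂⟩ := exists_dual_vectors ρ κ hρ hind3 0 Complex.I
  rw [Complex.ofReal_one] at hρ₀
  rw [Complex.ofReal_zero] at hρ₁ hρ₂
  have H1 (x y z : V) := DFunLike.congr_fun h1 ![x, y, z]
  have H2 (x y z : V) := DFunLike.congr_fun h2 ![x, y, z]
  simp only [AlternatingMap.add_apply, AlternatingMap.sub_apply, AlternatingMap.neg_apply,
    AlternatingMap.smul_apply, AlternatingMap.zero_apply, smul_eq_mul, cwedge_apply_two_one,
    cwedge_apply_one_one, hc1, hc2] at H1 H2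
  -- contraction of the second hypothesis with `e₁`
  let A : CForm V 2 := Ω₁ + W • cwedge ζ (cconj κ)
  let B : CForm V 2 := Ω₂ + (R : ℂ) • cwedge ζ (cconj κ)
  let α : CForm V 1 := -(A.curryLeft e₁)
  let β : CForm V 1 := -(B.curryLeft e₁)
  have hα (x : V) : α ![x] = Ω₁ ![x, e₁] + W * (ζ ![x] - ζ ![e₁] * starRingEnd ℂ (κ ![x])) := by
    change -(A ![e₁, x]) = _
    simp [A, cwedge_apply_one_one, hc1, hκ₁, Ω₁.fin_two_swap x e₁]; ring
  have hβ (x : V) : β ![x] = Ω₂ ![x, e₁] + R * (ζ ![x] - ζ ![e₁] * starRingEnd ℂ (κ ![x])) := by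
    change -(B ![e₁, x]) = _
    simp [B, cwedge_apply_one_one, hc1, hκ₁, Ω₂.fin_two_swap x e₁]; ring
  have hΩ (x y : V) : Ω₁ ![x, y] = α ![x] * κ ![y] - α ![y] * κ ![x]
      + β ![x] * ρ ![y] - β ![y] * ρ ![x]
      - W * (ζ ![x] * starRingEnd ℂ (κ ![y]) - ζ ![y] * starRingEnd ℂ (κ ![x])) := by
    have h := H2 x y e₁
    rw [hρ₁, hκ₁, map_one] at h
    rw [hα, hα, hβ, hβ]
    linear_combination h
  -- reality condition modulo `ρ`
  let t (x : V) : ℂ := α ![x] - starRingEnd ℂ W * starRingEnd ℂ (ζ ![x])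
  let C (x : V) : ℂ := β ![x] + starRingEnd ℂ (β ![x])
    - (Ω₁ ![x, e₀] + starRingEnd ℂ (Ω₁ ![x, e₀]))
  have ht (x : V) : α ![x] = t x + starRingEnd ℂ W * starRingEnd ℂ (ζ ![x]) := by
    simp only [t]; ring
  have hT (x y : V) : t x * κ ![y] - t y * κ ![x]
      + (starRingEnd ℂ (t x) * starRingEnd ℂ (κ ![y]) - starRingEnd ℂ (t y) * starRingEnd ℂ (κ ![x]))
      + C x * ρ ![y] - C y * ρ ![x] = 0 := by
    have h := H1 x y e₀
    have hc := congrArg (starRingEnd ℂ) (hΩ x y)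
    have hxy := hΩ x y
    rw [ht, ht] at hc hxy
    simp only [map_sub, map_add, map_mul, Complex.conj_conj, hr] at hc
    rw [hρ₀] at h
    simp only [C]
    linear_combination h - hxy - hc
  have hT₁ (x : V) := hT x e₁
  have hT₂ (x : V) := hT x e₂
  have hT₁₂ := hT e₁ e₂
  simp only [hρ₁, hρ₂, hκ₁, hκ₂, map_one, Complex.conj_I] at hT₁ hT₂ hT₁₂
  obtain ⟨p, hp⟩ : ∃ p : ℝ, (p : ℂ)
      = -(starRingEnd ℂ (t e₁) - Complex.I * starRingEnd ℂ (t e₂)) / 2 := by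
    refine Complex.conj_eq_iff_real.mp ?_ |>.imp fun _ h => h.symm
    simp only [map_div₀, map_neg, map_sub, map_mul, Complex.conj_conj, Complex.conj_I, map_ofNat]
    linear_combination (Complex.I / 2) * hT₁₂ +
      ((starRingEnd ℂ (t e₁) - t e₁) / 2) * Complex.I_sq
  let c : ℂ := (C e₁ - Complex.I * C e₂) / 2
  have hτ (x : V) : t x = (t e₁ - Complex.I * t e₂) / 2 * κ ![x]
      - p * starRingEnd ℂ (κ ![x]) + c * ρ ![x] := by
    rw [hp]
    simp only [c]
    linear_combination (hT₁ x - Complex.I * hT₂ x) / 2 +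
      ((t x - starRingEnd ℂ (t x)) / 2) * Complex.I_sq
  let Pi : CForm V 1 := β - c • κ
  have hPi (x : V) : Pi ![x] = β ![x] - c * κ ![x] := rfl
  have hΩ₁ (x y : V) : Ω₁ ![x, y] = Pi ![x] * ρ ![y] - Pi ![y] * ρ ![x]
      + p * (κ ![x] * starRingEnd ℂ (κ ![y]) - κ ![y] * starRingEnd ℂ (κ ![x]))
      - starRingEnd ℂ W * (κ ![x] * starRingEnd ℂ (ζ ![y]) - κ ![y] * starRingEnd ℂ (ζ ![x]))
      - W * (ζ ![x] * starRingEnd ℂ (κ ![y]) - ζ ![y] * starRingEnd ℂ (κ ![x])) := by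
    rw [hΩ, ht, ht, hPi, hPi]
    linear_combination κ ![y] * hτ x - κ ![x] * hτ y
  let Θ : CForm V 2 := Ω₂ - cwedge Pi κ + (R : ℂ) • cwedge ζ (cconj κ)
  have hΘ (x y : V) : Θ ![x, y] = Ω₂ ![x, y] - (Pi ![x] * κ ![y] - Pi ![y] * κ ![x])
      + R * (ζ ![x] * starRingEnd ℂ (κ ![y]) - ζ ![y] * starRingEnd ℂ (κ ![x])) := by
    simp [Θ, cwedge_apply_one_one, hc1]
  let Psi : CForm V 1 := -(Θ.curryLeft e₀)
  have hPsi (x : V) : Psi ![x] = Θ ![x, e₀] := (Θ.fin_two_swap e₀ x).symm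
  refine ⟨p, Pi, Psi, ?_, ?_⟩
  · ext v
    rw [AlternatingMap.fin_two_apply_eq, hΩ₁, AlternatingMap.fin_two_apply_eq _ v]
    simp [cwedge_apply_one_one, hc1]
  · ext v
    rw [AlternatingMap.fin_two_apply_eq, AlternatingMap.fin_two_apply_eq _ v]
    generalize v 0 = x
    generalize v 1 = y
    simp only [AlternatingMap.add_apply, AlternatingMap.sub_apply, AlternatingMap.smul_apply,
      smul_eq_mul, cwedge_apply_one_one, hc1]
    have h := H2 x y e₀
    rw [hΩ₁, hΩ₁, hΩ₁, hρ₀, hκ₀, map_zero] at h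
    rw [hPsi, hPsi, hΘ, hΘ, hκ₀, map_zero]
    linear_combination h
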